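/- arXiv:2407.00650 — 4 statements merged into one kernel-verified Lean document; each statement's English description precedes it below -/
import Mathlib

section
/- Define T⁰(x) = x·1_{[0,1)}(x) + 1_{[1,∞)}(x) (plateau function) and T¹(x) = (1/2 − |x − 1/2|)·1_{[0,1]}(x) (triangle function), and for l ∈ ℤ, m ≥ 0 set T⁰_l(x) = T⁰(x − l) and T¹_{l,m}(x) = 2^{−m/2} T¹(2^m x − l). Then for every Borel probability measure F on ℝ with finite first moment and every y ∈ ℝ, the continuous ranked probability score satisfies CRPS(F, y) = Σ_{l ∈ ℤ} (E_F[T⁰(X − l)] − T⁰(y − l))² + Σ_{l ∈ ℤ} Σ_{m ≥ 0} 2^{−m} (E_F[T¹(2^m X − l)] − T¹(2^m y − l))². -/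
open MeasureTheory

/-- The plateau function `T⁰(x) = x·1_{[0,1)}(x) + 1_{[1,∞)}(x)`. -/
noncomputable def plateau (x : ℝ) : ℝ :=
  if x < 0 then 0 else if x < 1 then x else 1

/-- The triangle function `T¹(x) = (1/2 − |x − 1/2|)·1_{[0,1]}(x)`. -/
noncomputable def triangle (x : ℝ) : ℝ :=
  if 0 ≤ x ∧ x ≤ 1 then 1 / 2 - |x - 1 / 2| else 0

lemma plateau_eq (x : ℝ) : plateau x = max x 0 - max (x-1) 0 := by
  unfold plateau
  split_ifs with h1 h2
  · rw [max_eq_right h1.le, max_eq_right (by linarith)]; simp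
  · rw [max_eq_left (by linarith), max_eq_right (by linarith)]; simp
  · rw [max_eq_left (by linarith), max_eq_left (by linarith)]; simp

lemma plateau_half (x : ℝ) : plateau x = (plateau (2*x) + plateau (2*x-1))/2 := by
  unfold plateau
  split_ifs <;> linarith

lemma triangle_eq (x : ℝ) : triangle x = (plateau (2*x) - plateau (2*x-1))/2 := by
  unfold plateau triangle
  rcases abs_cases (x - 1/2) with ⟨h, h'⟩ | ⟨h, h'⟩ <;> rw [h] <;> split_ifs with h1 <;>
    first | linarith | (exfalso; apply h1; constructor <;> linarith)

lemma plateau_cont : Continuous plateau := by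
  have : plateau = fun x => max x 0 - max (x-1) 0 := funext plateau_eq
  rw [this]; fun_prop

lemma plateau_nonneg (x : ℝ) : 0 ≤ plateau x := by
  unfold plateau; split_ifs <;> linarith
lemma plateau_le (x : ℝ) : plateau x ≤ 1 := by
  unfold plateau; split_ifs <;> linarith
lemma plateau_mono : Monotone plateau := by
  intro a b h
  unfold plateau; split_ifs <;> linarith

lemma triangle_cont : Continuous triangle := by
  have : triangle = fun x => (plateau (2*x) - plateau (2*x-1))/2 := funext triangle_eq
  have h := plateau_cont
  rw [this]; fun_prop

lemma triangle_abs (x : ℝ) : |triangle x| ≤ 1 := by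
  rw [triangle_eq, abs_le]
  have := plateau_nonneg (2*x)
  have := plateau_nonneg (2*x-1)
  have := plateau_le (2*x)
  have := plateau_le (2*x-1)
  constructor <;> linarith

lemma sum_plateau (x : ℝ) (L M : ℤ) (h : L ≤ M) :
    ∑ l ∈ Finset.Ico L M, plateau (x - l) = max (x - L) 0 - max (x - M) 0 := by
  induction M, h using Int.leInduction with
  | base => simp
  | succ M h ih =>
    rw [← Finset.insert_Ico_right_eq_Ico_add_one h, Finset.sum_insert (by simp), ih, plateau_eq]
    push_cast
    rw [show x - (M:ℝ) - 1 = x - (M+1) by ring]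
    ring

lemma plateau_zero {x : ℝ} (h : x ≤ 0) : plateau x = 0 := by
  unfold plateau; split_ifs <;> linarith
lemma plateau_one {x : ℝ} (h : 1 ≤ x) : plateau x = 1 := by
  unfold plateau; split_ifs <;> linarith

/-- differences have finite support and sum to b - a -/
lemma diff_supp (a b : ℝ) : ∃ s : Finset ℤ, (∀ l ∉ s, plateau (b - l) - plateau (a - l) = 0) ∧
    ∑ l ∈ s, (plateau (b - l) - plateau (a - l)) = b - a := by
  obtain ⟨L, hL⟩ := exists_int_lt (min a b)
  obtain ⟨M, hM⟩ := exists_int_gt (max a b)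
  rw [lt_min_iff] at hL
  rw [max_lt_iff] at hM
  have hLM : L ≤ M := by
    have : (L:ℝ) ≤ M := by linarith [hL.1, hM.1]
    exact_mod_cast this
  refine ⟨Finset.Ico L M, ?_, ?_⟩
  · intro l hl
    rw [Finset.mem_Ico, not_and_or, not_le, not_lt] at hl
    rcases hl with hl | hl
    · have : (l:ℝ) + 1 ≤ L := by exact_mod_cast hl
      rw [plateau_one (by linarith [hL.2]), plateau_one (by linarith [hL.1])]; simp
    · have : (M:ℝ) ≤ l := by exact_mod_cast hl
      rw [plateau_zero (by linarith [hM.2]), plateau_zero (by linarith [hM.1])]; simp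
  · rw [Finset.sum_sub_distrib, sum_plateau _ _ _ hLM, sum_plateau _ _ _ hLM,
      max_eq_left (show 0 ≤ b - L by linarith [hL.2]), max_eq_left (show 0 ≤ a - L by linarith [hL.1]),
      max_eq_right (show b - M ≤ 0 by linarith [hM.2]), max_eq_right (show a - M ≤ 0 by linarith [hM.1])]
    ring

lemma plateau_floor (x : ℝ) (l : ℤ) (h : l ≠ ⌊x⌋) : plateau (x - l) = 0 ∨ plateau (x - l) = 1 := by
  rcases lt_or_gt_of_ne h with h | h
  · right
    apply plateau_one
    have h1 : (l:ℝ) + 1 ≤ ⌊x⌋ := by exact_mod_cast h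
    linarith [Int.floor_le x]
  · left
    apply plateau_zero
    have h1 : (⌊x⌋:ℝ) + 1 ≤ l := by exact_mod_cast h
    linarith [Int.lt_floor_add_one x]

noncomputable def PP (a b : ℝ) : ℝ := ∑' l : ℤ, (plateau (a - l) - plateau (b - l))^2

lemma hasSum_PP (a b : ℝ) : HasSum (fun l : ℤ => (plateau (a - l) - plateau (b - l))^2) (PP a b) := by
  obtain ⟨s, hs, -⟩ := diff_supp b a
  apply Summable.hasSum
  exact summable_of_ne_finset_zero (s := s) (fun l hl => by rw [hs l hl]; simp)

lemma PP_symm (a b : ℝ) : PP a b = PP b a := by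
  unfold PP; congr 1; ext l; ring

lemma PP_bounds (a b : ℝ) : |a - b| - 2 ≤ PP a b ∧ PP a b ≤ |a - b| := by
  wlog h : a ≤ b generalizing a b
  · rw [PP_symm, abs_sub_comm]; exact this b a (by linarith)
  rw [PP_symm, abs_sub_comm, abs_of_nonneg (by linarith)]
  have hP := hasSum_PP b a
  obtain ⟨s, hs, hs2⟩ := diff_supp a b
  have hD : HasSum (fun l : ℤ => plateau (b - l) - plateau (a - l)) (b - a) := by
    rw [← hs2]; exact hasSum_sum_of_ne_finset_zero hs
  have key : ∀ l : ℤ, 0 ≤ plateau (b - l) - plateau (a - l) ∧ plateau (b - l) - plateau (a - l) ≤ 1 := by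
    intro l
    have := plateau_nonneg (a - l)
    have := plateau_le (b - l)
    have := plateau_mono (show a - l ≤ b - l by linarith)
    constructor <;> linarith
  constructor
  · have hI := (hasSum_ite_eq (⌊a⌋) (1:ℝ)).add (hasSum_ite_eq (⌊b⌋) (1:ℝ))
    have := hasSum_le (fun l => ?_) hD (hP.add hI)
    · linarith
    · obtain ⟨k1, k2⟩ := key l
      by_cases ha : l = ⌊a⌋
      · rw [if_pos ha]
        split_ifs <;> nlinarith [sq_nonneg (plateau (b - l) - plateau (a - l))]
      · by_cases hb : l = ⌊b⌋
        · rw [if_pos hb]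
          split_ifs <;> nlinarith [sq_nonneg (plateau (b - l) - plateau (a - l))]
        · rw [if_neg ha, if_neg hb]
          rcases plateau_floor a l ha with h1 | h1 <;> rcases plateau_floor b l hb with h2 | h2 <;> rw [h1, h2] <;> norm_num
  · refine hasSum_le (fun l => ?_) hP hD
    obtain ⟨k1, k2⟩ := key l
    nlinarith

lemma int_even_odd {f : ℤ → ℝ} {m m' : ℝ} (he : HasSum (fun k ↦ f (2 * k)) m)
    (ho : HasSum (fun k ↦ f (2 * k + 1)) m') : HasSum f (m + m') := by
  have := mul_right_injective₀ (two_ne_zero' ℤ)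
  replace ho := ((add_left_injective 1).comp this).hasSum_range_iff.2 ho
  refine (this.hasSum_range_iff.2 he).add_isCompl ?_ ho
  simpa [Function.comp_def] using Int.isCompl_even_odd

lemma hasSum_tri (a b : ℝ) : HasSum (fun l : ℤ => (triangle (a - l) - triangle (b - l))^2)
    (PP (2*a) (2*b) / 2 - PP a b) := by
  have h := hasSum_PP (2*a) (2*b)
  have he : HasSum (fun l : ℤ => (plateau (2*a - (2*l:ℤ)) - plateau (2*b - (2*l:ℤ)))^2 + (plateau (2*a - (2*l+1:ℤ)) - plateau (2*b - (2*l+1:ℤ)))^2) (PP (2*a) (2*b)) := by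
    have i1 : Function.Injective (fun l : ℤ => 2*l) := fun x y h => by simpa using h
    have i2 : Function.Injective (fun l : ℤ => 2*l+1) := fun x y h => by simpa using h
    have s1 := (h.summable.comp_injective i1).hasSum
    have s2 := (h.summable.comp_injective i2).hasSum
    have s3 := int_even_odd (f := fun l : ℤ => (plateau (2*a - l) - plateau (2*b - l))^2) s1 s2
    rw [h.unique s3]
    exact s1.add s2
  convert! (he.div_const 2).sub (hasSum_PP a b) using 2 with l
  rw [triangle_eq, triangle_eq, plateau_half (a - l), plateau_half (b - l)]
  push_cast
  rw [show 2 * (a - (l:ℝ)) = 2 * a - 2 * l by ring, show 2 * (b - (l:ℝ)) = 2 * b - 2 * l by ring,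
    show 2 * a - (2 * (l:ℝ) + 1) = 2 * a - 2 * l - 1 by ring,
    show 2 * b - (2 * (l:ℝ) + 1) = 2 * b - 2 * l - 1 by ring]
  ring

noncomputable def RR (a b : ℝ) (m : ℕ) : ℝ := (2:ℝ)^(-(m:ℤ)) * PP (2^m*a) (2^m*b)

lemma hasSum_level (a b : ℝ) (m : ℕ) :
    HasSum (fun l : ℤ => (2:ℝ)^(-(m:ℤ)) * (triangle (2^m*a - l) - triangle (2^m*b - l))^2)
      (RR a b (m+1) - RR a b m) := by
  convert! (hasSum_tri (2^m*a) (2^m*b)).mul_left ((2:ℝ)^(-(m:ℤ))) using 1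
  unfold RR
  rw [← mul_assoc, ← mul_assoc, ← pow_succ']
  have : (2:ℝ)^(-((m+1:ℕ):ℤ)) = (2:ℝ)^(-(m:ℤ)) / 2 := by
    push_cast
    rw [neg_add, zpow_add₀ (by norm_num)]
    norm_num; ring
  rw [this]; ring

lemma RR_tendsto (a b : ℝ) : Filter.Tendsto (RR a b) Filter.atTop (nhds |a - b|) := by
  have h0 : Filter.Tendsto (fun m : ℕ => (1/2:ℝ)^m) Filter.atTop (nhds 0) :=
    tendsto_pow_atTop_nhds_zero_of_lt_one (by norm_num) (by norm_num)
  have h1 : Filter.Tendsto (fun m : ℕ => |a - b| - (1/2:ℝ)^m * 2) Filter.atTop (nhds |a - b|) := by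
    simpa using (h0.mul_const 2).const_sub |a - b|
  have e : ∀ m : ℕ, (2:ℝ)^(-(m:ℤ)) = (1/2:ℝ)^m := fun m => by simp
  have e2 : ∀ m : ℕ, (1/2:ℝ)^m * |2^m*a - 2^m*b| = |a - b| := fun m => by
    rw [← mul_sub, abs_mul, abs_of_pos (by positivity : (0:ℝ) < 2^m), ← mul_assoc, ← mul_pow]
    norm_num
  refine tendsto_of_tendsto_of_tendsto_of_le_of_le h1 tendsto_const_nhds ?_ ?_
  · intro m
    have := mul_le_mul_of_nonneg_left (PP_bounds (2^m*a) (2^m*b)).1 (by positivity : (0:ℝ) ≤ (1/2)^m)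
    rw [mul_sub, e2] at this
    simpa only [RR, e] using this
  · intro m
    have := mul_le_mul_of_nonneg_left (PP_bounds (2^m*a) (2^m*b)).2 (by positivity : (0:ℝ) ≤ (1/2)^m)
    rw [e2] at this
    simpa only [RR, e] using this

noncomputable def hh : ℤ ⊕ (ℤ × ℕ) → ℝ → ℝ
  | .inl l, x => plateau (x - l)
  | .inr (l, m), x => triangle (2^m * x - l)

noncomputable def ww : ℤ ⊕ (ℤ × ℕ) → ℝ
  | .inl _ => 1
  | .inr (_, m) => (2:ℝ)^(-(m:ℤ))

lemma ww_nonneg (i) : 0 ≤ ww i := by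
  rcases i with l | ⟨l, m⟩ <;> simp only [ww] <;> positivity

lemma hasSum_pt (a b : ℝ) : HasSum (fun i => ww i * (hh i a - hh i b)^2) |a - b| := by
  have h1 : HasSum ((fun i => ww i * (hh i a - hh i b)^2) ∘ Sum.inl) (PP a b) := by
    simpa [Function.comp_def, ww, hh] using hasSum_PP a b
  have hm : HasSum (fun m => RR a b (m+1) - RR a b m) (|a-b| - PP a b) := by
    rw [hasSum_iff_tendsto_nat_of_nonneg]
    · simp only [Finset.sum_range_sub]
      have := (RR_tendsto a b).sub_const (RR a b 0)
      simpa [RR] using this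
    · intro m
      exact (hasSum_level a b m).nonneg (fun l => by positivity)
  have hs : Summable (fun p : ℕ × ℤ =>
      (2:ℝ)^(-(p.1:ℤ)) * (triangle (2^p.1*a - p.2) - triangle (2^p.1*b - p.2))^2) := by
    rw [summable_prod_of_nonneg (fun p => by positivity)]
    refine ⟨fun m => (hasSum_level a b m).summable, ?_⟩
    simp only [(hasSum_level a b _).tsum_eq]
    exact hm.summable
  have h2 : HasSum ((fun i => ww i * (hh i a - hh i b)^2) ∘ Sum.inr) (|a-b| - PP a b) := by
    rw [← (Equiv.prodComm ℕ ℤ).hasSum_iff]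
    have := hs.hasSum
    rw [hs.tsum_prod] at this
    simp only [(hasSum_level a b _).tsum_eq, hm.tsum_eq] at this
    exact this
  simpa using h1.sum h2

lemma hh_cont (i) : Continuous (hh i) := by
  have := plateau_cont
  have := triangle_cont
  rcases i with l | ⟨l, m⟩
  · change Continuous (fun x => plateau (x - l)); fun_prop
  · change Continuous (fun x => triangle (2^m * x - l)); fun_prop

lemma hh_abs (i x) : |hh i x| ≤ 1 := by
  rcases i with l | ⟨l, m⟩
  · simp only [hh]
    rw [abs_of_nonneg (plateau_nonneg _)]; exact plateau_le _
  · exact triangle_abs _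

lemma hasSum_int {ι : Type*} [Countable ι] (μ : Measure ℝ) (f : ι → ℝ → ℝ) (g : ℝ → ℝ)
    (hf : ∀ i, Continuous (f i)) (h0 : ∀ i x, 0 ≤ f i x) (hs : ∀ x, HasSum (fun i => f i x) (g x))
    (hg : Integrable g μ) : HasSum (fun i => ∫ x, f i x ∂μ) (∫ x, g x ∂μ) := by
  refine hasSum_integral_of_dominated_convergence f (fun i => (hf i).aestronglyMeasurable) ?_ ?_ ?_ ?_
  · intro i; filter_upwards with x
    rw [Real.norm_of_nonneg (h0 i x)]
  · filter_upwards with x using (hs x).summable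
  · simpa only [(hs _).tsum_eq] using hg
  · filter_upwards with x using hs x

/-- **Wavelet series representation of the CRPS.**
For every Borel probability measure `F` on `ℝ` with finite first moment and every
observation `y`,
`CRPS(F, y) = Σ_{l ∈ ℤ} (E_F[T⁰(X − l)] − T⁰(y − l))²
  + Σ_{l ∈ ℤ} Σ_{m ≥ 0} 2^{−m} (E_F[T¹(2^m X − l)] − T¹(2^m y − l))²`,
where `CRPS(F, y) = E_F|X − y| − (1/2) E_F|X − X'|`. -/
theorem crps_wavelet_series_representation
    (F : Measure ℝ) [IsProbabilityMeasure F]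
    (hF : Integrable (fun x => |x|) F) (y : ℝ) :
    (∫ x, |x - y| ∂F) - (1 / 2) * (∫ x, ∫ x', |x - x'| ∂F ∂F)
      = (∑' l : ℤ, ((∫ x, plateau (x - l) ∂F) - plateau (y - l)) ^ 2)
        + ∑' l : ℤ, ∑' m : ℕ, (2 : ℝ) ^ (-(m : ℤ)) *
            ((∫ x, triangle (2 ^ m * x - l) ∂F) - triangle (2 ^ m * y - l)) ^ 2 := by
  have hid : Integrable (fun x : ℝ => x) F :=
    (integrable_norm_iff (by fun_prop)).1 hF
  have i1 : ∀ i, Integrable (hh i) F := fun i =>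
    Integrable.of_bound (hh_cont i).aestronglyMeasurable 1 (by filter_upwards with x using hh_abs i x)
  have i2 : ∀ i, Integrable (fun x => hh i x ^ 2) F := fun i =>
    Integrable.of_bound ((hh_cont i).pow 2).aestronglyMeasurable 1 (by
      filter_upwards with x
      rw [norm_pow]
      exact pow_le_one₀ (norm_nonneg _) (hh_abs i x))
  -- integral of the squared difference
  have hint : ∀ i c, ∫ x, ww i * (c - hh i x)^2 ∂F
      = ww i * (c^2 - 2 * c * (∫ x, hh i x ∂F) + ∫ x, hh i x ^ 2 ∂F) := by
    intro i c
    rw [integral_const_mul]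
    congr 1
    have : ∀ x, (c - hh i x)^2 = (c^2 - 2 * c * hh i x) + hh i x ^ 2 := fun x => by ring
    simp only [this]
    rw [integral_add (f := fun x => c^2 - 2 * c * hh i x) (((integrable_const _)).sub ((i1 i).const_mul _)) (i2 i),
      integral_sub (integrable_const _) ((i1 i).const_mul _), integral_const_mul]
    simp
  have s1 : HasSum (fun i => ∫ x, ww i * (hh i y - hh i x)^2 ∂F) (∫ x, |y - x| ∂F) := by
    refine hasSum_int F _ _ (fun i => ?_) (fun i x => ?_) (fun x => hasSum_pt y x) ?_
    · have := hh_cont i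
      fun_prop
    · have := ww_nonneg i
      positivity
    · exact ((integrable_const y).sub hid).abs
  have ip : Integrable (fun p : ℝ × ℝ => |p.1 - p.2|) (F.prod F) :=
    ((hid.comp_fst F).sub (hid.comp_snd F)).abs
  have s2 : HasSum (fun i => ∫ x, ∫ x', ww i * (hh i x - hh i x')^2 ∂F ∂F)
      (∫ x, ∫ x', |x - x'| ∂F ∂F) := by
    refine hasSum_int F _ _ (fun i => ?_) (fun i x => ?_) (fun x => ?_) ip.integral_prod_left
    · have := hh_cont i
      simp only [hint]
      fun_prop
    · have := ww_nonneg i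
      exact integral_nonneg (fun x' => by positivity)
    · refine hasSum_int F _ _ (fun i => ?_) (fun i x' => ?_) (fun x' => hasSum_pt x x') ?_
      · have := hh_cont i
        fun_prop
      · have := ww_nonneg i
        positivity
      · exact ((integrable_const x).sub hid).abs
  have s3 := s1.sub (s2.mul_left (1/2))
  have e : ∀ i, (∫ x, ww i * (hh i y - hh i x)^2 ∂F)
      - 1/2 * (∫ x, ∫ x', ww i * (hh i x - hh i x')^2 ∂F ∂F)
      = ww i * ((∫ x, hh i x ∂F) - hh i y)^2 := by
    intro i
    simp only [hint]
    rw [integral_const_mul, integral_add (f := fun x => hh i x ^ 2 - 2 * hh i x * ∫ x, hh i x ∂F)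
      ((i2 i).sub (((i1 i).const_mul 2).mul_const _)) (integrable_const _),
      integral_sub (i2 i) (((i1 i).const_mul 2).mul_const _), integral_mul_const, integral_const_mul]
    simp
    ring
  simp only [e] at s3
  simp only [abs_sub_comm _ y]
  rw [← s3.tsum_eq]
  have t1 := s3.summable.comp_injective Sum.inl_injective
  have t2 := s3.summable.comp_injective Sum.inr_injective
  rw [Summable.tsum_sum t1 t2]
  congr 1
  · simp [ww, hh]
  · exact t2.tsum_prod
end

section
/- Let 0 < α < 1 and let F, G be Borel probability measures on ℝ with finite first moments, with cumulative distribution functions F and G and quantile functions F⁻¹ and G⁻¹. Then the expected quantile score of level α satisfies E_{Y~G}[QS_α(F, Y)] = E_{Y~G}[QS_α(G, Y)] + (G(F⁻¹(α)) − α)(F⁻¹(α) − G⁻¹(α)) − ∫_{G⁻¹(α)}^{F⁻¹(α)} (y − G⁻¹(α)) G(dy). -/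
open MeasureTheory ProbabilityTheory

/-- The quantile of level `α` of a Borel probability measure on `ℝ`:
`F⁻¹(α) = inf {x : F(x) ≥ α}`, where `F` also denotes the cumulative distribution function. -/
noncomputable def quantile (μ : Measure ℝ) (α : ℝ) : ℝ :=
  sInf {x : ℝ | α ≤ cdf μ x}

/-- The quantile score of level `α`:
`QS_α(F, y) = (1_{y ≤ F⁻¹(α)} − α)(F⁻¹(α) − y)`. -/
noncomputable def quantileScore (μ : Measure ℝ) (α : ℝ) (y : ℝ) : ℝ :=
  ((if y ≤ quantile μ α then (1 : ℝ) else 0) - α) * (quantile μ α - y)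

/-- **Expected quantile score.**
For `0 < α < 1` and Borel probability measures `F`, `G` on `ℝ` with finite first moments,
`E_{Y~G}[QS_α(F, Y)] = E_{Y~G}[QS_α(G, Y)] + (G(F⁻¹(α)) − α)(F⁻¹(α) − G⁻¹(α))
  − ∫_{G⁻¹(α)}^{F⁻¹(α)} (y − G⁻¹(α)) G(dy)`. -/
theorem expected_quantile_score
    (α : ℝ) (hα0 : 0 < α) (hα1 : α < 1)
    (F G : Measure ℝ) [IsProbabilityMeasure F] [IsProbabilityMeasure G]
    (hF : Integrable (fun x => |x|) F) (hG : Integrable (fun x => |x|) G) :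
    ∫ y, quantileScore F α y ∂G
      = (∫ y, quantileScore G α y ∂G)
        + (cdf G (quantile F α) - α) * (quantile F α - quantile G α)
        - ∫ y in (quantile G α)..(quantile F α), (y - quantile G α) ∂G := by
  have hid : Integrable (fun y : ℝ => y) G := by
    rw [← integrable_norm_iff (by fun_prop)]
    simpa [Real.norm_eq_abs] using hG
  unfold quantileScore
  generalize quantile F α = b
  generalize quantile G α = a
  have hint : ∀ c d : ℝ, Integrable
      (fun y => ((if y ≤ c then (1 : ℝ) else 0) - α) * (d - y)) G := by
    intro c d
    have h1 : Integrable (fun y => d - y) G := (integrable_const d).sub hid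
    have h2 : Integrable ((Set.Iic c).indicator (fun y => d - y)) G :=
      h1.indicator measurableSet_Iic
    refine (h2.sub (h1.const_mul α)).congr (Filter.Eventually.of_forall fun y => ?_)
    by_cases h : y ≤ c <;> simp [Set.indicator, h] <;> ring
  have hsub : Integrable (fun y => y - a) G := hid.sub (integrable_const a)
  have hi1 : Integrable ((Set.Iic b).indicator (fun _ => (1 : ℝ))) G :=
    (integrable_const (1 : ℝ)).indicator measurableSet_Iic
  have hi2 : Integrable (fun y => ((Set.Iic b).indicator (fun _ => (1 : ℝ)) y - α) * (b - a)) G :=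
    (hi1.sub (integrable_const α)).mul_const _
  have hA : Integrable ((Set.Ioc a b).indicator (fun y => y - a)) G :=
    hsub.indicator measurableSet_Ioc
  have hB : Integrable ((Set.Ioc b a).indicator (fun y => y - a)) G :=
    hsub.indicator measurableSet_Ioc
  have hc : ∫ y, ((Set.Iic b).indicator (fun _ => (1 : ℝ)) y - α) * (b - a) ∂G
      = (cdf G b - α) * (b - a) := by
    rw [integral_mul_const, integral_sub hi1 (integrable_const α),
      integral_indicator measurableSet_Iic, cdf_eq_real]
    simp
  rw [intervalIntegral, ← integral_indicator measurableSet_Ioc,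
    ← integral_indicator measurableSet_Ioc, ← hc, ← integral_add (hint a a) hi2,
    ← integral_sub hA hB]
  refine Eq.trans ?_ (integral_sub ((hint a a).add hi2) (hA.sub hB))
  refine integral_congr_ae (Filter.Eventually.of_forall fun y => ?_)
  simp only [Pi.add_apply, Pi.sub_apply]
  by_cases h1 : y ≤ a <;> by_cases h2 : y ≤ b <;>
    simp [Set.indicator, h1, h2, not_lt.mpr, lt_of_not_ge] <;> grind
end

section
/- Let F and G be Borel probability measures on ℝ with finite first moments and cumulative distribution functions F and G. Then the expected continuous ranked probability score satisfies E_{Y~G}[CRPS(F, Y)] = ∫_ℝ (F(z) − G(z))² dz + ∫_ℝ G(z)(1 − G(z)) dz. -/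
open MeasureTheory ProbabilityTheory

lemma crps_kernel_norm (x z : ℝ) :
    ‖(if x ≤ z then (1 : ℝ) else 0) - (if 0 ≤ z then (1 : ℝ) else 0)‖
      = (Set.Ico (min x 0) (max x 0)).indicator (fun _ => (1 : ℝ)) z := by
  simp only [Set.indicator_apply, Set.mem_Ico, min_le_iff, lt_max_iff]
  split_ifs <;> first | (norm_num; done) | (exfalso; grind)

lemma crps_meas_ind : Measurable (fun p : ℝ × ℝ => if p.1 ≤ p.2 then (1 : ℝ) else 0) :=
  Measurable.ite (measurableSet_le measurable_fst measurable_snd) measurable_const measurable_const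

lemma crps_meas_ind0 : Measurable (fun z : ℝ => if 0 ≤ z then (1 : ℝ) else 0) :=
  Measurable.ite (measurableSet_le measurable_const measurable_id) measurable_const measurable_const

lemma crps_kernel_int (F : Measure ℝ) [IsProbabilityMeasure F]
    (hF : Integrable (fun x => |x|) F) :
    Integrable (fun p : ℝ × ℝ => (if p.1 ≤ p.2 then (1 : ℝ) else 0)
      - (if 0 ≤ p.2 then (1 : ℝ) else 0)) (F.prod volume) := by
  have hm : Measurable (fun p : ℝ × ℝ => (if p.1 ≤ p.2 then (1 : ℝ) else 0)
      - (if 0 ≤ p.2 then (1 : ℝ) else 0)) :=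
    crps_meas_ind.sub (crps_meas_ind0.comp measurable_snd)
  rw [integrable_prod_iff hm.aestronglyMeasurable]
  constructor
  · refine Filter.Eventually.of_forall fun x => ?_
    refine (integrable_norm_iff (hm.comp measurable_prodMk_left).aestronglyMeasurable).1 ?_
    simp only [Function.comp_apply]
    simp only [crps_kernel_norm]
    rw [integrable_indicator_iff measurableSet_Ico]
    exact integrableOn_const (by simp)
  · simp only [crps_kernel_norm]
    refine hF.congr (Filter.Eventually.of_forall fun x => ?_)
    simp only [integral_indicator measurableSet_Ico]
    simp [max_sub_min_eq_abs]

lemma crps_integral_ind (G : Measure ℝ) [IsProbabilityMeasure G] (z : ℝ) :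
    ∫ y, (if y ≤ z then (1 : ℝ) else 0) ∂G = cdf G z := by
  rw [cdf_eq_real, ← integral_indicator_one measurableSet_Iic]
  rfl

lemma crps_int_ind (G : Measure ℝ) [IsProbabilityMeasure G] (z : ℝ) :
    Integrable (fun y => if y ≤ z then (1 : ℝ) else 0) G :=
  (integrable_const (1 : ℝ)).indicator (measurableSet_Iic (a := z))

lemma crps_D_int (F : Measure ℝ) [IsProbabilityMeasure F]
    (hF : Integrable (fun x => |x|) F) :
    Integrable (fun z : ℝ => cdf F z - (if 0 ≤ z then (1 : ℝ) else 0)) volume := by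
  refine (crps_kernel_int F hF).integral_prod_right.congr (Filter.Eventually.of_forall fun z => ?_)
  refine (integral_sub (crps_int_ind F z)
    (integrable_const (if 0 ≤ z then (1 : ℝ) else 0))).trans ?_
  rw [crps_integral_ind, integral_const]
  simp

/-- **Expected continuous ranked probability score.**
For Borel probability measures `F`, `G` on `ℝ` with finite first moments and cdfs `F`, `G`,
`E_{Y~G}[CRPS(F, Y)] = ∫_ℝ (F(z) − G(z))² dz + ∫_ℝ G(z)(1 − G(z)) dz`,
where `CRPS(F, y) = ∫_ℝ (F(z) − 1_{y ≤ z})² dz`. -/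
theorem expected_crps
    (F G : Measure ℝ) [IsProbabilityMeasure F] [IsProbabilityMeasure G]
    (hF : Integrable (fun x => |x|) F) (hG : Integrable (fun x => |x|) G) :
    ∫ y, (∫ z, (cdf F z - (if y ≤ z then (1 : ℝ) else 0)) ^ 2) ∂G
      = (∫ z, (cdf F z - cdf G z) ^ 2) + ∫ z, cdf G z * (1 - cdf G z) := by
  have hmF : Measurable (fun z => cdf F z) := (monotone_cdf F).measurable
  have hmG : Measurable (fun z => cdf G z) := (monotone_cdf G).measurable
  have hDF := crps_D_int F hF
  have hDG := crps_D_int G hG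
  have sq_le : ∀ a b c : ℝ, 0 ≤ a → a ≤ 1 → 0 ≤ b → b ≤ 1 →
      ‖(a - b) ^ 2‖ ≤ ‖a - c‖ + ‖b - c‖ := by
    intro a b c ha ha' hb hb'
    have h1 : |a - b| ≤ 1 := abs_le.2 ⟨by linarith, by linarith⟩
    have h2 : |a - b| ≤ |a - c| + |b - c| := by
      rw [abs_sub_comm b c]; exact abs_sub_le a c b
    simp only [norm_pow, Real.norm_eq_abs]
    nlinarith [abs_nonneg (a - b)]
  have hprod : Integrable (Function.uncurry fun y z : ℝ =>
      (cdf F z - (if y ≤ z then (1 : ℝ) else 0)) ^ 2) (G.prod volume) := by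
    refine ((hDF.comp_snd G).norm.add (crps_kernel_int G hG).norm).mono'
      (((hmF.comp measurable_snd).sub crps_meas_ind).pow_const 2).aestronglyMeasurable
      (Filter.Eventually.of_forall fun p => ?_)
    refine sq_le _ _ _ (cdf_nonneg F _) (cdf_le_one F _) ?_ ?_ <;> split_ifs <;> norm_num
  have h1 : Integrable (fun z => (cdf F z - cdf G z) ^ 2) := by
    refine (hDF.norm.add hDG.norm).mono' ((hmF.sub hmG).pow_const 2).aestronglyMeasurable
      (Filter.Eventually.of_forall fun z => ?_)
    exact sq_le _ _ _ (cdf_nonneg F _) (cdf_le_one F _) (cdf_nonneg G _) (cdf_le_one G _)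
  have h2 : Integrable (fun z => cdf G z * (1 - cdf G z)) := by
    refine hDG.norm.mono' (hmG.mul (measurable_const.sub hmG)).aestronglyMeasurable
      (Filter.Eventually.of_forall fun z => ?_)
    have ha := cdf_nonneg G z
    have hb := cdf_le_one G z
    rw [Real.norm_of_nonneg (mul_nonneg ha (by linarith)), Real.norm_eq_abs]
    split_ifs
    · rw [abs_sub_comm, abs_of_nonneg (by linarith)]; nlinarith
    · rw [sub_zero, abs_of_nonneg ha]; nlinarith
  rw [integral_integral_swap hprod, ← integral_add h1 h2]
  congr 1
  ext z
  have e : ∀ y : ℝ, (cdf F z - (if y ≤ z then (1 : ℝ) else 0)) ^ 2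
      = (cdf F z) ^ 2 + (1 - 2 * cdf F z) * (if y ≤ z then (1 : ℝ) else 0) := by
    intro y; split_ifs <;> ring
  simp only [e]
  rw [integral_add (integrable_const _) ((crps_int_ind G z).const_mul _), integral_const_mul,
    crps_integral_ind]
  simp
  ring
end

section
/- Let F and G be Borel probability measures on ℝ with strictly positive, twice continuously differentiable Lebesgue densities f and g satisfying f'(x)/f(x) → 0 and g(x) f'(x)/f(x) → 0 as |x| → ∞, and assume all integrals below are finite. Then the expected Hyvärinen score satisfies E_{Y~G}[2 f''(Y)/f(Y) − (f'(Y)/f(Y))²] = ∫_ℝ ((f'(y)/f(y))² − 2 (f'(y)/f(y))(g'(y)/g(y))) g(y) dy = ∫_ℝ (f'(y)/f(y) − g'(y)/g(y))² g(y) dy − ∫_ℝ (g'(y)/g(y))² g(y) dy. -/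
open MeasureTheory

/-- **Expected Hyvärinen score.**
For Borel probability measures `F`, `G` on `ℝ` with strictly positive, twice continuously
differentiable Lebesgue densities `f`, `g` with `f'/f → 0` and `g·f'/f → 0` at infinity,
and all integrals finite,
`E_{Y~G}[2 f''(Y)/f(Y) − (f'(Y)/f(Y))²]
  = ∫ ((f'/f)² − 2 (f'/f)(g'/g)) g
  = ∫ (f'/f − g'/g)² g − ∫ (g'/g)² g`. -/
theorem expected_hyvarinen_score
    (f g : ℝ → ℝ) (hf : ContDiff ℝ 2 f) (hg : ContDiff ℝ 2 g)
    (hfpos : ∀ x, 0 < f x) (hgpos : ∀ x, 0 < g x)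
    (F G : Measure ℝ)
    (hFd : F = volume.withDensity fun x => ENNReal.ofReal (f x))
    (hGd : G = volume.withDensity fun x => ENNReal.ofReal (g x))
    [IsProbabilityMeasure F] [IsProbabilityMeasure G]
    (hlim1 : Filter.Tendsto (fun x => deriv f x / f x) (Filter.cocompact ℝ) (nhds 0))
    (hlim2 : Filter.Tendsto (fun x => g x * (deriv f x / f x)) (Filter.cocompact ℝ) (nhds 0))
    (hint1 : Integrable
      (fun y => 2 * deriv (deriv f) y / f y - (deriv f y / f y) ^ 2) G)
    (hint2 : Integrable fun y =>
      ((deriv f y / f y) ^ 2 - 2 * (deriv f y / f y) * (deriv g y / g y)) * g y)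
    (hint3 : Integrable fun y => (deriv f y / f y - deriv g y / g y) ^ 2 * g y)
    (hint4 : Integrable fun y => (deriv g y / g y) ^ 2 * g y) :
    (∫ y, (2 * deriv (deriv f) y / f y - (deriv f y / f y) ^ 2) ∂G
      = ∫ y, ((deriv f y / f y) ^ 2 - 2 * (deriv f y / f y) * (deriv g y / g y)) * g y) ∧
    (∫ y, ((deriv f y / f y) ^ 2 - 2 * (deriv f y / f y) * (deriv g y / g y)) * g y
      = (∫ y, (deriv f y / f y - deriv g y / g y) ^ 2 * g y)
        - ∫ y, (deriv g y / g y) ^ 2 * g y) := by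
  have hgc : Continuous g := hg.continuous
  have hm : Measurable fun x => ENNReal.ofReal (g x) := hgc.measurable.ennreal_ofReal
  have hI1 : Integrable fun y =>
      (2 * deriv (deriv f) y / f y - (deriv f y / f y) ^ 2) * g y := by
    rw [hGd, integrable_withDensity_iff hm (by simp)] at hint1
    simpa [ENNReal.toReal_ofReal (hgpos _).le] using hint1
  have hE1 : ∫ y, (2 * deriv (deriv f) y / f y - (deriv f y / f y) ^ 2) ∂G
      = ∫ y, (2 * deriv (deriv f) y / f y - (deriv f y / f y) ^ 2) * g y := by
    rw [hGd, integral_withDensity_eq_integral_toReal_smul hm (by simp)]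
    refine integral_congr_ae (Filter.Eventually.of_forall fun y => ?_)
    simp [ENNReal.toReal_ofReal (hgpos _).le, mul_comm]
  have hfd : Differentiable ℝ f := hf.differentiable (by norm_num)
  have hgd : Differentiable ℝ g := hg.differentiable (by norm_num)
  have hfd' : Differentiable ℝ (deriv f) :=
    ((contDiff_succ_iff_deriv (n := 1)).1 (by simpa [one_add_one_eq_two] using hf)).2.2.differentiable
      (by norm_num)
  have hD : ∀ x, HasDerivAt (fun x => 2 * (g x * (deriv f x / f x)))
      ((2 * deriv (deriv f) x / f x - (deriv f x / f x) ^ 2) * g x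
        - ((deriv f x / f x) ^ 2 - 2 * (deriv f x / f x) * (deriv g x / g x)) * g x) x := by
    intro x
    have h1 := (hgd x).hasDerivAt.mul
      ((hfd' x).hasDerivAt.div (hfd x).hasDerivAt (hfpos x).ne')
    refine (h1.const_mul 2).congr_deriv ?_
    have := (hfpos x).ne'
    have := (hgpos x).ne'
    simp only [Pi.div_apply]
    field_simp
    ring
  have hl : Filter.Tendsto (fun x => 2 * (g x * (deriv f x / f x)))
      (Filter.cocompact ℝ) (nhds 0) := by
    simpa using hlim2.const_mul 2
  have key := integral_of_hasDerivAt_of_tendsto hD (hI1.sub hint2)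
    (hl.mono_left atBot_le_cocompact) (hl.mono_left atTop_le_cocompact)
  rw [integral_sub hI1 hint2] at key
  refine ⟨by rw [hE1]; linarith, ?_⟩
  rw [← integral_sub hint3 hint4]
  refine integral_congr_ae (Filter.Eventually.of_forall fun y => ?_)
  simp only
  ring
end
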